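/- arXiv:2403.09310 — 2 statements merged into one kernel-verified Lean document; each statement's English description precedes it below -/
import Mathlib

section
/- For every T > 0 and constants C_σ ≥ 1, C_ν ≥ 1 there exists a constant C_SGD > 1 (depending only on C_σ, C_ν and T) with the following property. Let n ≥ 1, K ≤ nT a natural number, data points x_1 = (z_1,y_1), …, x_K = (z_K,y_K) ∈ ℝ^{d'}×ℝ, ν_0 a probability measure on ℝ×ℝ^{d'} supported in the closed ball of radius C_ν centered at 0, ν_k := (SGD^{x_k, ν_{k−1}})_* ν_{k−1}, θ_0 with ‖θ_0‖ ≤ C_ν and θ_k := θ_{k−1} + (1/n)·A(x_k, θ_{k−1}; ν_{k−1}) for 1 ≤ k ≤ K. Then for every 0 ≤ k ≤ K one has ‖θ_k‖ ≤ C_ν + C_SGD·(T²+1)·(1 + (1/n)·Σ_{i=1}^{K}|y_i|⁴ + (1/n)·Σ_{i=1}^{K}(1+‖z_i‖²)). -/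
open MeasureTheory ProbabilityTheory Real Set Filter
open scoped ENNReal NNReal InnerProductSpace Topology

noncomputable section

attribute [local instance] MeasureTheory.Measure.Subtype.measureSpace

/-- Parameters `(c, w) ∈ ℝ × ℝ^{d'}`. -/
abbrev Param (d' : ℕ) := ℝ × EuclideanSpace ℝ (Fin d')
/-- Data points `(z, y) ∈ ℝ^{d'} × ℝ`. -/
abbrev Data (d' : ℕ) := EuclideanSpace ℝ (Fin d') × ℝ

/-- The network output `F(z, μ) = ∫ c·σ(zᵀw) dμ(c,w)`. -/
def netF {d' : ℕ} (σ : ℝ → ℝ) (z : EuclideanSpace ℝ (Fin d'))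
    (μ : Measure (Param d')) : ℝ :=
  ∫ p, p.1 * σ ⟪z, p.2⟫_ℝ ∂μ

/-- `g((z,y), μ) = y − F(z, μ)`. -/
def lossG {d' : ℕ} (σ : ℝ → ℝ) (x : Data d') (μ : Measure (Param d')) : ℝ :=
  x.2 - netF σ x.1 μ

/-- The gradient `A((z,y), (c,w); μ)`. -/
def gradA {d' : ℕ} (σ : ℝ → ℝ) (x : Data d') (θ : Param d')
    (μ : Measure (Param d')) : Param d' :=
  (lossG σ x μ * σ ⟪x.1, θ.2⟫_ℝ, (lossG σ x μ * θ.1 * deriv σ ⟪x.1, θ.2⟫_ℝ) • x.1)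

/-- Euclidean norm on parameters `ℝ × ℝ^{d'}`. -/
def pnorm {d' : ℕ} (θ : Param d') : ℝ := Real.sqrt (θ.1 ^ 2 + ‖θ.2‖ ^ 2)

/-- Euclidean norm on data points `ℝ^{d'} × ℝ`. -/
def dnorm {d' : ℕ} (x : Data d') : ℝ := Real.sqrt (‖x.1‖ ^ 2 + x.2 ^ 2)

/-- The SGD update map `SGD^{x,μ}(c,w) = (c,w) + (1/n)·A(x,(c,w);μ)`. -/
def sgdStep {d' : ℕ} (n : ℕ) (σ : ℝ → ℝ) (x : Data d')
    (μ : Measure (Param d')) (θ : Param d') : Param d' :=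
  θ + (n : ℝ)⁻¹ • gradA σ x θ μ

lemma lossG_bd {d' : ℕ} {σ : ℝ → ℝ} {Cσ M : ℝ} (hσ : ∀ u, |σ u| ≤ Cσ) (hC : 1 ≤ Cσ)
    (x : Data d') (μ : Measure (Param d')) [IsProbabilityMeasure μ]
    (h : ∀ᵐ p ∂μ, |p.1| ≤ M) : |lossG σ x μ| ≤ |x.2| + Cσ * M := by
  have h1 : ‖netF σ x.1 μ‖ ≤ (Cσ * M) * μ.real univ := by
    unfold netF
    apply norm_integral_le_of_norm_le_const
    filter_upwards [h] with p hp
    rw [norm_mul, Real.norm_eq_abs, Real.norm_eq_abs, mul_comm]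
    exact mul_le_mul (hσ _) hp (abs_nonneg _) (by linarith)
  simp only [probReal_univ, mul_one, Real.norm_eq_abs] at h1
  unfold lossG
  exact (abs_sub _ _).trans (by linarith)

lemma sgdStep_meas {d' : ℕ} (n : ℕ) {σ : ℝ → ℝ} (hd : Differentiable ℝ σ) (x : Data d')
    (μ : Measure (Param d')) : Measurable (sgdStep n σ x μ) := by
  have h1 : Measurable σ := hd.continuous.measurable
  have h2 : Measurable (deriv σ) := measurable_deriv σ
  have h3 : Measurable (fun θ : Param d' => ⟪x.1, θ.2⟫_ℝ) := by fun_prop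
  have h4 := h1.comp h3
  have h5 := h2.comp h3
  unfold sgdStep gradA
  have h6 : Measurable (fun θ : Param d' => (lossG σ x μ * σ ⟪x.1, θ.2⟫_ℝ,
      (lossG σ x μ * θ.1 * deriv σ ⟪x.1, θ.2⟫_ℝ) • x.1)) :=
    Measurable.prodMk (h4.const_mul _) (((measurable_fst.const_mul _).mul h5).smul_const _)
  exact measurable_id.add (h6.const_smul ((n : ℝ)⁻¹))

lemma step_fst {d' : ℕ} (n : ℕ) {σ : ℝ → ℝ} {Cσ M : ℝ} (hσ : ∀ u, |σ u| ≤ Cσ) (hC : 1 ≤ Cσ)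
    (x : Data d') (μ : Measure (Param d')) [IsProbabilityMeasure μ]
    (h : ∀ᵐ p ∂μ, |p.1| ≤ M) (θ : Param d') (hθ : |θ.1| ≤ M) :
    |(sgdStep n σ x μ θ).1| ≤ M + (n : ℝ)⁻¹ * ((|x.2| + Cσ * M) * Cσ) := by
  have hg := lossG_bd hσ hC x μ h
  have e : (sgdStep n σ x μ θ).1 = θ.1 + (n : ℝ)⁻¹ * (lossG σ x μ * σ ⟪x.1, θ.2⟫_ℝ) := rfl
  rw [e]
  refine (abs_add_le _ _).trans (add_le_add hθ ?_)
  rw [abs_mul, abs_mul, abs_of_nonneg (by positivity : (0:ℝ) ≤ (n : ℝ)⁻¹)]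
  have := mul_le_mul hg (hσ ⟪x.1, θ.2⟫_ℝ) (abs_nonneg _) ((abs_nonneg _).trans hg)
  gcongr

lemma step_snd {d' : ℕ} (n : ℕ) {σ : ℝ → ℝ} {Cσ M B : ℝ} (hσ : ∀ u, |σ u| ≤ Cσ)
    (hσ' : ∀ u, |deriv σ u| ≤ Cσ) (hC : 1 ≤ Cσ)
    (x : Data d') (μ : Measure (Param d')) [IsProbabilityMeasure μ]
    (h : ∀ᵐ p ∂μ, |p.1| ≤ M) (θ : Param d') (hθ : |θ.1| ≤ M) (hMB : M ≤ B) :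
    ‖(sgdStep n σ x μ θ).2‖ ≤ ‖θ.2‖ +
      (n : ℝ)⁻¹ * (Cσ * (|x.2| ^ 4 + (1 + ‖x.1‖ ^ 2) + (1 + 2 * Cσ ^ 2) * B ^ 4)) := by
  have hg := lossG_bd hσ hC x μ h
  have hB : 0 ≤ B := (abs_nonneg _).trans (hθ.trans hMB)
  have hg' : |lossG σ x μ| ≤ |x.2| + Cσ * B := by
    refine hg.trans ?_
    gcongr
  have e : (sgdStep n σ x μ θ).2 = θ.2 + (n : ℝ)⁻¹ •
    ((lossG σ x μ * θ.1 * deriv σ ⟪x.1, θ.2⟫_ℝ) • x.1) := rfl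
  rw [e]
  refine (norm_add_le _ _).trans (add_le_add le_rfl ?_)
  rw [norm_smul, norm_smul, Real.norm_eq_abs, Real.norm_eq_abs, abs_mul, abs_mul,
    abs_of_nonneg (by positivity : (0:ℝ) ≤ (n : ℝ)⁻¹)]
  have h1 : |lossG σ x μ| * |θ.1| * |deriv σ ⟪x.1, θ.2⟫_ℝ| * ‖x.1‖ ≤
      (|x.2| + Cσ * B) * B * Cσ * ‖x.1‖ := by
    have := hθ.trans hMB
    have := hσ' ⟪x.1, θ.2⟫_ℝ
    gcongr
  refine mul_le_mul_of_nonneg_left (h1.trans ?_) (by positivity)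
  have h2 : (|x.2| + Cσ * B) * B * ‖x.1‖ ≤
      |x.2| ^ 4 + (1 + ‖x.1‖ ^ 2) + (1 + 2 * Cσ ^ 2) * B ^ 4 := by
    set y := |x.2|
    set z := ‖x.1‖
    have a1 := sq_nonneg (y * B - z)
    have a2 := sq_nonneg (Cσ * B ^ 2 - z)
    have a3 := sq_nonneg (y ^ 2 - B ^ 2)
    have a4 : 0 ≤ y ^ 4 := by positivity
    have a5 : 0 ≤ B ^ 4 := by positivity
    have a6 : 0 ≤ Cσ ^ 2 * B ^ 4 := by positivity
    nlinarith
  calc _ = Cσ * ((|x.2| + Cσ * B) * B * ‖x.1‖) := by ring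
    _ ≤ _ := by gcongr

lemma abs_fst_le_pnorm {d' : ℕ} (p : Param d') : |p.1| ≤ pnorm p := by
  unfold pnorm
  exact Real.abs_le_sqrt (by nlinarith [sq_nonneg ‖p.2‖])

lemma snd_le_pnorm {d' : ℕ} (p : Param d') : ‖p.2‖ ≤ pnorm p := by
  unfold pnorm
  exact Real.le_sqrt_of_sq_le (by nlinarith [sq_nonneg p.1])

lemma pnorm_le {d' : ℕ} (p : Param d') : pnorm p ≤ |p.1| + ‖p.2‖ := by
  unfold pnorm
  rw [Real.sqrt_le_left (by positivity)]
  have := mul_nonneg (abs_nonneg p.1) (norm_nonneg p.2)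
  nlinarith [sq_abs p.1]

lemma pow_four_sum (K : ℕ) (f : ℕ → ℝ) :
    (∑ i ∈ Finset.Icc 1 K, |f i|) ^ 4 ≤ (K : ℝ) ^ 3 * ∑ i ∈ Finset.Icc 1 K, |f i| ^ 4 := by
  have h1 := sq_sum_le_card_mul_sum_sq (s := Finset.Icc 1 K) (f := fun i => |f i|)
  have h2 := sq_sum_le_card_mul_sum_sq (s := Finset.Icc 1 K) (f := fun i => |f i| ^ 2)
  simp only [Nat.card_Icc, Nat.add_sub_cancel, ← pow_mul] at h1 h2
  norm_num at h2
  calc (∑ i ∈ Finset.Icc 1 K, |f i|) ^ 4 = ((∑ i ∈ Finset.Icc 1 K, |f i|) ^ 2) ^ 2 := by ring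
    _ ≤ (K * ∑ i ∈ Finset.Icc 1 K, |f i| ^ 2) ^ 2 := by gcongr
    _ = (K:ℝ) ^ 2 * (∑ i ∈ Finset.Icc 1 K, |f i| ^ 2) ^ 2 := by ring
    _ ≤ (K:ℝ) ^ 2 * (K * ∑ i ∈ Finset.Icc 1 K, |f i| ^ 4) := by
        gcongr
        simpa using h2
    _ = _ := by ring

set_option maxHeartbeats 1600000 in
/-- uniform bound on the Euclidean norm of the SGD weight trajectory. -/
theorem sgd_trajectory_norm_bound (T Cσ Cν : ℝ) (hT : 0 < T) (hCσ : 1 ≤ Cσ) (hCν : 1 ≤ Cν) :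
    ∃ CSGD : ℝ, 1 < CSGD ∧
      ∀ (d' : ℕ) (σ : ℝ → ℝ), Differentiable ℝ σ → (∀ u, |σ u| ≤ Cσ) →
        (∀ u, |deriv σ u| ≤ Cσ) →
      ∀ (n K : ℕ), 1 ≤ n → (K : ℝ) ≤ n * T →
      ∀ (x : ℕ → Data d') (ν : ℕ → Measure (Param d')) (θ : ℕ → Param d'),
        IsProbabilityMeasure (ν 0) → (∀ᵐ p ∂(ν 0), pnorm p ≤ Cν) →
        (∀ k < K, ν (k + 1) = (ν k).map (sgdStep n σ (x (k + 1)) (ν k))) →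
        pnorm (θ 0) ≤ Cν →
        (∀ k < K, θ (k + 1) = θ k + (n : ℝ)⁻¹ • gradA σ (x (k + 1)) (θ k) (ν k)) →
        ∀ k ≤ K, pnorm (θ k) ≤
          Cν + CSGD * (T ^ 2 + 1) *
            (1 + (n : ℝ)⁻¹ * ∑ i ∈ Finset.Icc 1 K, |(x i).2| ^ 4 +
              (n : ℝ)⁻¹ * ∑ i ∈ Finset.Icc 1 K, (1 + ‖(x i).1‖ ^ 2)) := by
  set E : ℝ := Real.exp (Cσ ^ 2 * T) with hE
  set P : ℝ := 8 * E ^ 4 * (Cν ^ 4 + Cσ ^ 4 * T ^ 3) with hP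
  set Q : ℝ := 1 + P + Cσ * (1 + T * (1 + 2 * Cσ ^ 2) * P) with hQ
  have hE0 : 0 < E := Real.exp_pos _
  have hP0 : 0 < P := by positivity
  have hQ1 : 1 < Q := by
    have : 0 ≤ Cσ * (1 + T * (1 + 2 * Cσ ^ 2) * P) := by positivity
    linarith
  refine ⟨Q, hQ1, ?_⟩
  intro d' σ hd hσ hσ' n K hn hK x ν θ hν0 hsupp hν hθ0 hθ
  have hn0 : (0:ℝ) < n := by exact_mod_cast hn
  set a : ℝ := Cσ ^ 2 * (n:ℝ)⁻¹ with ha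
  have ha0 : 0 ≤ a := by positivity
  let M : ℕ → ℝ := fun k =>
    (1 + a) ^ k * (Cν + Cσ * (n:ℝ)⁻¹ * ∑ i ∈ Finset.Icc 1 k, |(x i).2|)
  set S := (n : ℝ)⁻¹ * ∑ i ∈ Finset.Icc 1 K, |(x i).2| ^ 4 with hS
  set Z := (n : ℝ)⁻¹ * ∑ i ∈ Finset.Icc 1 K, (1 + ‖(x i).1‖ ^ 2) with hZ
  set Y := (n : ℝ)⁻¹ * ∑ i ∈ Finset.Icc 1 K, |(x i).2| with hY
  set B := E * (Cν + Cσ * Y) with hB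
  have hS0 : 0 ≤ S := by positivity
  have hZ0 : 0 ≤ Z := by positivity
  have hY0 : 0 ≤ Y := by positivity
  have hB0 : 0 ≤ B := by positivity
  have hKT : (n:ℝ)⁻¹ * K ≤ T := by
    rw [inv_mul_le_iff₀ hn0]; exact hK
  have hMstep : ∀ k, M k + (n : ℝ)⁻¹ * ((|(x (k+1)).2| + Cσ * M k) * Cσ) ≤ M (k+1) := by
    intro k
    have h1 : (1:ℝ) ≤ (1 + a) ^ (k+1) := one_le_pow₀ (by linarith)
    have e : M (k+1) = (1 + a) * M k + (1+a)^(k+1) * (Cσ * (n:ℝ)⁻¹ * |(x (k+1)).2|) := by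
      simp only [M]
      rw [Finset.sum_Icc_succ_top (by omega)]
      ring
    have h2 : 0 ≤ Cσ * (n:ℝ)⁻¹ * |(x (k+1)).2| := by positivity
    have h3 := le_mul_of_one_le_left h2 h1
    rw [e]
    calc _ = (1 + a) * M k + Cσ * (n:ℝ)⁻¹ * |(x (k+1)).2| := by rw [ha]; ring
      _ ≤ _ := by linarith
  have hMB : ∀ k ≤ K, M k ≤ B := by
    intro k hk
    have h1 : (1 + a) ^ k ≤ E := by
      calc (1 + a) ^ k ≤ (Real.exp a) ^ k := by
            gcongr
            linarith [Real.add_one_le_exp a]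
        _ = Real.exp (k * a) := by rw [Real.exp_nat_mul]
        _ ≤ E := by
          rw [hE]
          apply Real.exp_le_exp.mpr
          have : (k:ℝ) ≤ K := by exact_mod_cast hk
          calc (k:ℝ) * a ≤ K * a := by gcongr
            _ = Cσ ^ 2 * ((n:ℝ)⁻¹ * K) := by rw [ha]; ring
            _ ≤ _ := by gcongr
    have h2 : ∑ i ∈ Finset.Icc 1 k, |(x i).2| ≤ ∑ i ∈ Finset.Icc 1 K, |(x i).2| :=
      Finset.sum_le_sum_of_subset_of_nonneg (Finset.Icc_subset_Icc_right hk)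
        (fun _ _ _ => abs_nonneg _)
    have e : B = E * (Cν + Cσ * (n:ℝ)⁻¹ * ∑ i ∈ Finset.Icc 1 K, |(x i).2|) := by
      rw [hB, hY]; ring
    rw [e]
    simp only [M]
    gcongr
  have hM0 : M 0 = Cν := by simp [M]
  have main : ∀ k ≤ K, IsProbabilityMeasure (ν k) ∧ (∀ᵐ p ∂(ν k), |p.1| ≤ M k) ∧
      |(θ k).1| ≤ M k ∧ ‖(θ k).2‖ ≤ Cν + ∑ i ∈ Finset.Icc 1 k, (n : ℝ)⁻¹ *
        (Cσ * (|(x i).2| ^ 4 + (1 + ‖(x i).1‖ ^ 2) + (1 + 2 * Cσ ^ 2) * B ^ 4)) := by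
    intro k
    induction k with
    | zero =>
      intro _
      refine ⟨hν0, ?_, ?_, ?_⟩
      · rw [hM0]
        filter_upwards [hsupp] with p hp using (abs_fst_le_pnorm p).trans hp
      · rw [hM0]; exact (abs_fst_le_pnorm _).trans hθ0
      · simpa using (snd_le_pnorm _).trans hθ0
    | succ k ih =>
      intro hk
      obtain ⟨i1, i2, i3, i4⟩ := ih (by omega)
      have hm := sgdStep_meas n hd (x (k+1)) (ν k)
      have hθk : θ (k+1) = sgdStep n σ (x (k+1)) (ν k) (θ k) := hθ k (by omega)
      refine ⟨?_, ?_, ?_, ?_⟩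
      · rw [hν k (by omega)]
        exact Measure.isProbabilityMeasure_map hm.aemeasurable
      · rw [hν k (by omega), ae_map_iff hm.aemeasurable
          (measurableSet_le (by fun_prop) measurable_const)]
        filter_upwards [i2] with p hp
        exact (step_fst n hσ hCσ _ _ i2 p hp).trans (hMstep k)
      · rw [hθk]
        exact (step_fst n hσ hCσ _ _ i2 _ i3).trans (hMstep k)
      · rw [hθk, Finset.sum_Icc_succ_top (by omega), ← add_assoc]
        refine (step_snd n hσ hσ' hCσ _ _ i2 _ i3 (hMB k (by omega))).trans ?_
        gcongr
  intro k hk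
  obtain ⟨_, _, h3, h4⟩ := main k hk
  have h5 : ∑ i ∈ Finset.Icc 1 k, (n : ℝ)⁻¹ *
        (Cσ * (|(x i).2| ^ 4 + (1 + ‖(x i).1‖ ^ 2) + (1 + 2 * Cσ ^ 2) * B ^ 4)) ≤
      Cσ * (S + Z + (n:ℝ)⁻¹ * K * ((1 + 2 * Cσ ^ 2) * B ^ 4)) := by
    refine (Finset.sum_le_sum_of_subset_of_nonneg (Finset.Icc_subset_Icc_right hk)
        (fun _ _ _ => by positivity)).trans (le_of_eq ?_)
    rw [← Finset.mul_sum, ← Finset.mul_sum, Finset.sum_add_distrib, Finset.sum_add_distrib,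
      Finset.sum_const, hS, hZ]
    simp only [Nat.card_Icc, Nat.add_sub_cancel, nsmul_eq_mul]
    ring
  have hY4 : Y ^ 4 ≤ T ^ 3 * S := by
    have := pow_four_sum K (fun i => (x i).2)
    calc Y ^ 4 = (n:ℝ)⁻¹ ^ 4 * (∑ i ∈ Finset.Icc 1 K, |(x i).2|) ^ 4 := by rw [hY]; ring
      _ ≤ (n:ℝ)⁻¹ ^ 4 * ((K : ℝ) ^ 3 * ∑ i ∈ Finset.Icc 1 K, |(x i).2| ^ 4) := by gcongr
      _ = ((n:ℝ)⁻¹ * K) ^ 3 * S := by rw [hS]; ring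
      _ ≤ _ := by gcongr
  have hB4 : B ^ 4 ≤ P * (1 + S) := by
    have h8 : (Cν + Cσ * Y) ^ 4 ≤ 8 * (Cν ^ 4 + (Cσ * Y) ^ 4) := by
      have := add_pow_le (a := Cν) (b := Cσ * Y) (by linarith) (by positivity) 4
      norm_num at this
      exact this
    calc B ^ 4 = E ^ 4 * (Cν + Cσ * Y) ^ 4 := by rw [hB]; ring
      _ ≤ E ^ 4 * (8 * (Cν ^ 4 + (Cσ * Y) ^ 4)) := by gcongr
      _ = 8 * E ^ 4 * (Cν ^ 4 + Cσ ^ 4 * Y ^ 4) := by ring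
      _ ≤ 8 * E ^ 4 * (Cν ^ 4 + Cσ ^ 4 * (T ^ 3 * S)) := by gcongr
      _ ≤ 8 * E ^ 4 * (Cν ^ 4 + Cσ ^ 4 * (T ^ 3 * S)) +
          8 * E ^ 4 * (Cν ^ 4 * S + Cσ ^ 4 * T ^ 3) := by
        have : 0 ≤ 8 * E ^ 4 * (Cν ^ 4 * S + Cσ ^ 4 * T ^ 3) := by positivity
        linarith
      _ = _ := by rw [hP]; ring
  have hB1 : B ≤ 1 + B ^ 4 := by
    nlinarith [sq_nonneg (B ^ 2 - 1/2), sq_nonneg (B - 1/2)]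
  have h6 : Cσ * (S + Z + (n:ℝ)⁻¹ * K * ((1 + 2 * Cσ ^ 2) * B ^ 4)) ≤
      Cσ * (S + Z + T * ((1 + 2 * Cσ ^ 2) * (P * (1 + S)))) := by gcongr
  have h7 : pnorm (θ k) ≤ Cν + Q * (1 + S + Z) := by
    have := pnorm_le (θ k)
    have := hMB k hk
    have e : Q * (1 + S + Z) = (1 + P * (1 + S)) +
        Cσ * (S + Z + T * ((1 + 2 * Cσ ^ 2) * (P * (1 + S)))) +
        (S + Z + P * Z + Cσ + Cσ * T * (1 + 2 * Cσ ^ 2) * P * Z) := by rw [hQ]; ring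
    have : 0 ≤ S + Z + P * Z + Cσ + Cσ * T * (1 + 2 * Cσ ^ 2) * P * Z := by positivity
    linarith
  refine h7.trans ?_
  have : Q ≤ Q * (T ^ 2 + 1) := le_mul_of_one_le_right (by linarith) (by nlinarith)
  gcongr
end
end

section
/- Assume: σ : ℝ → ℝ is differentiable with |σ| ≤ C_σ, |σ'| ≤ C_σ (C_σ ≥ 1) and σ, σ' are Lipschitz with constant L_σ > 1; ν is a Borel probability measure on ℝ×ℝ^{d'} supported in the closed ball of radius C_ν ≥ 1 centered at 0; π is a Borel probability measure on ℝ^{d'}×ℝ supported in the closed ball of radius C_π ≥ 1 centered at 0; T > 0. Then there exists a constant C_traj > 0, depending only on C_σ, L_σ, C_ν, C_π and T, such that: for every Markov kernel (κ_s)_{s∈[0,T]} from [0,T] to ℝ^{d'}×ℝ with κ_s supported in the support of π for almost every s, and every Borel probability measure η on C([0,T], ℝ×ℝ^{d'}) whose time-0 marginal is ν, whose time-s marginals satisfy ∫|c| dη_s(c,w) < ∞ for all s, and for which η-almost every path θ satisfies θ_t = θ_0 + ∫_0^t ∫ A(x, θ_s; η_s) κ_s(dx) ds for all t ∈ [0,T],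 it holds that η-almost every path θ satisfies sup_{t∈[0,T]} ‖θ_t‖ ≤ C_traj. -/
open MeasureTheory ProbabilityTheory Set Filter
open scoped ENNReal NNReal InnerProductSpace Topology

noncomputable section

attribute [local instance] MeasureTheory.Measure.Subtype.measureSpace

/-- The space `C([0,T], ℝ × ℝ^{d'})` of continuous paths with the uniform topology. -/
abbrev PathSpace (d' : ℕ) (T : ℝ) := C(Set.Icc (0 : ℝ) T, Param d')

instance (d' : ℕ) (T : ℝ) : MeasurableSpace (PathSpace d' T) := borel _
instance (d' : ℕ) (T : ℝ) : BorelSpace (PathSpace d' T) := ⟨rfl⟩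

/-- The (topological) support of a measure: points all of whose neighborhoods have
positive measure. -/
def msupport {X : Type*} [TopologicalSpace X] [MeasurableSpace X] (π : Measure X) : Set X :=
  {x | ∀ U ∈ nhds x, π U ≠ 0}

lemma aux_small {T a b : ℝ} {m : ℝ → ℝ} (ha : 0 ≤ a) (hb : 0 < b) (hm : ∀ x, 0 ≤ m x)
    (H : ∀ s ∈ Icc 0 T, ∀ t ∈ Icc 0 T, ∀ S : ℝ, (∀ r ∈ uIcc s t, m r ≤ S) →
      m t ≤ m s + |t - s| * (a + b * S))
    {s t : ℝ} (hs : s ∈ Icc 0 T) (ht : t ∈ Icc 0 T) (hst : b * |t - s| ≤ 1 / 2)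
    (hB : ∃ B, ∀ r ∈ uIcc s t, m r ≤ B) : m t ≤ 2 * (m s + a * |t - s|) := by
  obtain ⟨B, hB⟩ := hB
  set S := sSup (m '' uIcc s t) with hS
  have hbdd : BddAbove (m '' uIcc s t) := ⟨B, by rintro _ ⟨r, hr, rfl⟩; exact hB r hr⟩
  have hle : ∀ r ∈ uIcc s t, m r ≤ S := fun r hr => le_csSup hbdd ⟨r, hr, rfl⟩
  have hS0 : 0 ≤ S := (hm s).trans (hle s left_mem_uIcc)
  have key : S ≤ m s + |t - s| * (a + b * S) := by
    refine csSup_le (s := m '' uIcc s t) ⟨m s, s, left_mem_uIcc, rfl⟩ ?_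
    rintro _ ⟨r, hr, rfl⟩
    have hr' : r ∈ Icc 0 T := (ordConnected_Icc.uIcc_subset hs ht) hr
    have h1 := H s hs r hr' S (fun q hq => hle q ((uIcc_subset_uIcc_left hr) hq))
    have h2 : |r - s| ≤ |t - s| := abs_sub_left_of_mem_uIcc hr
    have h3 : |r - s| * (a + b * S) ≤ |t - s| * (a + b * S) := by gcongr
    linarith
  have h4 : b * |t - s| * S ≤ 1 / 2 * S := by gcongr
  have := hle t right_mem_uIcc
  nlinarith

lemma aux_bdd {T a b : ℝ} {m : ℝ → ℝ} (ha : 0 ≤ a) (hb : 0 < b) (hm : ∀ x, 0 ≤ m x)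
    (hcl : ∀ S : ℝ, IsClosed {x | x ∈ Icc 0 T ∧ m x ≤ S})
    (H : ∀ s ∈ Icc 0 T, ∀ t ∈ Icc 0 T, ∀ S : ℝ, (∀ r ∈ uIcc s t, m r ≤ S) →
      m t ≤ m s + |t - s| * (a + b * S)) :
    ∃ B, ∀ x ∈ Icc 0 T, m x ≤ B := by
  set LB : ℝ → Prop := fun x => ∃ ε > 0, ∃ B, ∀ y ∈ Icc 0 T, |y - x| < ε → m y ≤ B with hLB
  set K : Set ℝ := {x | x ∈ Icc 0 T ∧ ¬ LB x} with hK
  -- boundedness on compact intervals avoiding `K`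
  have hcomp : ∀ s ∈ Icc 0 T, ∀ t ∈ Icc 0 T, (∀ r ∈ uIcc s t, r ∉ K) →
      ∃ B, ∀ r ∈ uIcc s t, m r ≤ B := by
    intro s hs t ht hr
    have hsub : uIcc s t ⊆ Icc 0 T := ordConnected_Icc.uIcc_subset hs ht
    have : ∃ B, ∀ r ∈ uIcc s t, r ∈ Icc 0 T → m r ≤ B := by
      refine IsCompact.induction_on (p := fun A => ∃ B, ∀ r ∈ A, r ∈ Icc 0 T → m r ≤ B)
        isCompact_uIcc ⟨0, by simp⟩ ?_ ?_ ?_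
      · rintro A A' hAA ⟨B, hB⟩
        exact ⟨B, fun r hr => hB r (hAA hr)⟩
      · rintro A A' ⟨B, hB⟩ ⟨B', hB'⟩
        refine ⟨max B B', fun r hr hr' => ?_⟩
        rcases hr with hr | hr
        · exact (hB r hr hr').trans (le_max_left _ _)
        · exact (hB' r hr hr').trans (le_max_right _ _)
      · intro x hx
        have hxl : LB x := by
          by_contra hc
          exact hr x hx ⟨hsub hx, hc⟩
        obtain ⟨ε, hε, B, hB⟩ := hxl
        refine ⟨Metric.ball x ε, mem_nhdsWithin_of_mem_nhds (Metric.ball_mem_nhds x hε), B, ?_⟩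
        intro y hy hy'
        exact hB y hy' (by simpa [Real.dist_eq] using hy)
    obtain ⟨B, hB⟩ := this
    exact ⟨B, fun r hr => hB r hr (hsub hr)⟩
  have hKcl : IsClosed K := by
    have : K = Icc 0 T ∩ {x | LB x}ᶜ := by ext; simp [hK]
    rw [this]
    apply isClosed_Icc.inter
    rw [isClosed_compl_iff, Metric.isOpen_iff]
    rintro x ⟨ε, hε, B, hB⟩
    refine ⟨ε / 2, by positivity, fun z hz => ⟨ε / 2, by positivity, B, fun y hy hyz => ?_⟩⟩
    apply hB y hy
    rw [Metric.mem_ball, Real.dist_eq] at hz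
    have := abs_sub_le y z x
    linarith
  have hKe : K = ∅ := by
    by_contra hne
    have hne' : K.Nonempty := nonempty_iff_ne_empty.mpr hne
    have : Nonempty K := hne'.to_subtype
    have : CompleteSpace K := hKcl.isComplete.completeSpace_coe
    obtain ⟨n, ⟨x0, hx0⟩⟩ := nonempty_interior_of_iUnion_of_closed
      (f := fun n : ℕ => {x : K | m x ≤ n}) (by
        intro n
        have : {x : K | m x ≤ n} = Subtype.val ⁻¹' {x | x ∈ Icc 0 T ∧ m x ≤ n} := by
          ext x
          simp only [mem_ofPred_eq, mem_preimage]
          exact ⟨fun h => ⟨x.2.1, h⟩, fun h => h.2⟩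
        rw [this]
        exact (hcl n).preimage continuous_subtype_val) (by
        ext x
        simp only [mem_iUnion, mem_ofPred_eq, mem_univ, iff_true]
        exact exists_nat_ge _)
    rw [mem_interior_iff_mem_nhds, Metric.mem_nhds_iff] at hx0
    obtain ⟨ε, hε, hball⟩ := hx0
    have hn : ∀ y ∈ K, |y - x0| < ε → m y ≤ n := by
      intro y hy hyx
      exact @hball ⟨y, hy⟩ (by simpa [Subtype.dist_eq, Real.dist_eq] using hyx)
    apply x0.2.2
    refine ⟨min ε (1 / (2 * b)), by positivity, 2 * (n + a * ε), fun y hy hyx => ?_⟩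
    have hyε : |y - x0| < ε := hyx.trans_le (min_le_left _ _)
    have hyb : |y - x0| < 1 / (2 * b) := hyx.trans_le (min_le_right _ _)
    have hyb' : b * |y - x0| ≤ 1 / 2 := by
      rw [lt_div_iff₀ (by positivity)] at hyb
      linarith
    have hx0I : (x0 : ℝ) ∈ Icc 0 T := x0.2.1
    obtain ⟨α, ⟨hαK, hαI⟩, hαd⟩ := ((isCompact_uIcc (a := (x0 : ℝ)) (b := y)).inter_left
      hKcl).exists_infDist_eq_dist ⟨x0, x0.2, left_mem_uIcc⟩ y
    have hαT : α ∈ Icc 0 T := hαK.1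
    have hav : ∀ z ∈ uIcc α y, z ≠ α → z ∉ K := by
      intro z hz hza hzK
      have h1 := Metric.infDist_le_dist_of_mem (x := y)
        (show z ∈ K ∩ uIcc (x0 : ℝ) y from ⟨hzK, uIcc_subset_uIcc_right hαI hz⟩)
      rw [hαd, Real.dist_eq, Real.dist_eq] at h1
      apply hza
      rcases mem_uIcc.mp hz with h | h
      · rw [abs_of_nonneg (by linarith), abs_of_nonneg (by linarith)] at h1
        linarith
      · rw [abs_of_nonpos (by linarith), abs_of_nonpos (by linarith)] at h1
        linarith
    have hαy : |y - α| ≤ |y - x0| := abs_sub_right_of_mem_uIcc hαI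
    have hαx : |α - x0| ≤ |y - x0| := abs_sub_left_of_mem_uIcc hαI
    have hbd : ∃ B, ∀ r ∈ uIcc α y, m r ≤ B := by
      refine ⟨max (m α) (2 * (m y + a * |y - α|)), fun r hr => ?_⟩
      by_cases hra : r = α
      · rw [hra]; exact le_max_left _ _
      · refine le_trans ?_ (le_max_right _ _)
        have hrT : r ∈ Icc 0 T := ordConnected_Icc.uIcc_subset hαT hy hr
        have hry : |r - y| ≤ |y - α| := by
          rw [abs_sub_comm]; exact abs_sub_right_of_mem_uIcc hr
        have := aux_small ha hb hm H hy hrT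
          ((mul_le_mul_of_nonneg_left (hry.trans hαy) hb.le).trans hyb')
          (hcomp y hy r hrT (fun q hq => by
            rw [uIcc_comm] at hq
            apply hav q (uIcc_subset_uIcc_right hr hq)
            rintro rfl
            apply hra
            rcases mem_uIcc.mp hq with h | h <;> rcases mem_uIcc.mp hr with h' | h' <;> linarith))
        have h2 : a * |r - y| ≤ a * |y - α| := by gcongr
        linarith
    have h5 := aux_small ha hb hm H hαT hy
      ((mul_le_mul_of_nonneg_left hαy hb.le).trans hyb') hbd
    have h6 := hn α hαK (hαx.trans_lt hyε)
    have h7 : a * |y - α| ≤ a * ε := by gcongr; linarith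
    linarith
  by_cases hT : 0 ≤ T
  · obtain ⟨B, hB⟩ := hcomp 0 ⟨le_rfl, hT⟩ T ⟨hT, le_rfl⟩ (by simp [hKe])
    exact ⟨B, fun x hx => hB x (by rwa [uIcc_of_le hT])⟩
  · exact ⟨0, fun x hx => absurd (hx.1.trans hx.2) hT⟩

def Bseq (m0 a b : ℝ) : ℕ → ℝ
  | 0 => m0
  | k + 1 => 2 * (Bseq m0 a b k + a * (1 / (2 * b)))

lemma Bseq_nonneg {m0 a b : ℝ} (h0 : 0 ≤ m0) (ha : 0 ≤ a) (hb : 0 < b) (k : ℕ) :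
    0 ≤ Bseq m0 a b k := by
  induction k with
  | zero => exact h0
  | succ k ih => simp only [Bseq]; positivity

lemma aux_final {T a b m0 : ℝ} {m : ℝ → ℝ} (ha : 0 ≤ a) (hb : 0 < b) (hT : 0 ≤ T)
    (hm : ∀ x, 0 ≤ m x)
    (h0 : m 0 ≤ m0)
    (hcl : ∀ S : ℝ, IsClosed {x | x ∈ Icc 0 T ∧ m x ≤ S})
    (H : ∀ s ∈ Icc 0 T, ∀ t ∈ Icc 0 T, ∀ S : ℝ, (∀ r ∈ uIcc s t, m r ≤ S) →
      m t ≤ m s + |t - s| * (a + b * S)) :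
    ∀ x ∈ Icc 0 T, m x ≤ Bseq m0 a b ⌈T * (2 * b)⌉₊ := by
  obtain ⟨B, hB⟩ := aux_bdd ha hb hm hcl H
  have key : ∀ k : ℕ, ∀ x ∈ Icc 0 T, x ≤ k * (1 / (2 * b)) → m x ≤ Bseq m0 a b k := by
    intro k
    induction k with
    | zero =>
      intro x hx hx0
      have : x = 0 := le_antisymm (by simpa using hx0) hx.1
      rw [this]; exact h0
    | succ k ih =>
      intro x hx hxk
      push_cast at hxk
      have hδ : 0 < 1 / (2 * b) := by positivity
      set y := max 0 (x - 1 / (2 * b)) with hy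
      have hyx : y ≤ x := max_le hx.1 (by linarith)
      have hyT : y ∈ Icc 0 T := ⟨le_max_left _ _, hyx.trans hx.2⟩
      have hyk : y ≤ k * (1 / (2 * b)) := max_le (by positivity) (by linarith)
      have hd : |x - y| ≤ 1 / (2 * b) := by
        rw [abs_of_nonneg (by linarith)]
        have := le_max_right 0 (x - 1 / (2 * b))
        linarith
      have h1 := ih y hyT hyk
      have h2 := aux_small ha hb hm H hyT hx
        ((mul_le_mul_of_nonneg_left hd hb.le).trans (by field_simp; rfl))
        ⟨B, fun r hr => hB r (ordConnected_Icc.uIcc_subset hyT hx hr)⟩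
      have h3 : a * |x - y| ≤ a * (1 / (2 * b)) := by gcongr
      simp only [Bseq]
      linarith
  intro x hx
  apply key _ x hx
  have := Nat.le_ceil (T * (2 * b))
  rw [mul_one_div, le_div_iff₀ (by positivity)]
  exact (mul_le_mul_of_nonneg_right hx.2 (by positivity)).trans this

lemma aux_incr {T : ℝ} {E : Type*} [NormedAddCommGroup E] [NormedSpace ℝ E]
    {f : Icc (0 : ℝ) T → E} (hf : Integrable f) (s t : Icc (0 : ℝ) T) (hst : s ≤ t) (D : ℝ)
    (hD : ∀ᵐ u : Icc (0 : ℝ) T, u ∈ Icc s t → ‖f u‖ ≤ D) :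
    ‖(∫ u in {u : Icc (0 : ℝ) T | (u : ℝ) ≤ (t : ℝ)}, f u) -
      ∫ u in {u : Icc (0 : ℝ) T | (u : ℝ) ≤ (s : ℝ)}, f u‖ ≤ D * ((t : ℝ) - s) := by
  have hset : {u : Icc (0 : ℝ) T | (u : ℝ) ≤ (t : ℝ)} \ {u : Icc (0 : ℝ) T | (u : ℝ) ≤ (s : ℝ)}
      = Ioc s t := by
    ext u
    simp only [Set.mem_sdiff, mem_ofPred_eq, not_le, mem_Ioc, Subtype.coe_le_coe, Subtype.coe_lt_coe]
    tauto
  have hvol : volume (Ioc s t) = ENNReal.ofReal ((t : ℝ) - s) := by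
    change (Measure.comap Subtype.val volume) (Ioc s t) = _
    rw [comap_subtype_coe_apply measurableSet_Icc]
    have : (Subtype.val '' Ioc s t : Set ℝ) = Ioc (s : ℝ) t := by
      ext x
      constructor
      · rintro ⟨u, hu, rfl⟩; exact hu
      · intro hx
        exact ⟨⟨x, s.2.1.trans hx.1.le, hx.2.trans t.2.2⟩, hx, rfl⟩
    rw [this, Real.volume_Ioc]
  rw [← setIntegral_sdiff (measurableSet_le measurable_subtype_coe measurable_const)
    hf.integrableOn (show {u : Icc (0 : ℝ) T | (u : ℝ) ≤ (s : ℝ)} ⊆ {u : Icc (0 : ℝ) T | (u : ℝ) ≤ (t : ℝ)} from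
      fun u hu => le_trans (α := ℝ) hu hst), hset]
  have := norm_setIntegral_le_of_norm_le_const_ae' (μ := volume) (s := Ioc s t) (f := f) (C := D)
    (by rw [hvol]; exact ENNReal.ofReal_lt_top)
    (hD.mono fun u hu h => hu ⟨h.1.le, h.2⟩)
  rwa [Measure.real, hvol, ENNReal.toReal_ofReal (sub_nonneg.mpr hst)] at this

lemma aux_netF {d' : ℕ} {σ : ℝ → ℝ} {Cσ : ℝ} (hσ : ∀ u, |σ u| ≤ Cσ)
    (z : EuclideanSpace ℝ (Fin d')) {μ : Measure (Param d')}
    (hμ : Integrable (fun p : Param d' => |p.1|) μ) :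
    |netF σ z μ| ≤ Cσ * ∫ p, |p.1| ∂μ := by
  rw [netF, ← integral_const_mul]
  rw [← Real.norm_eq_abs]
  refine norm_integral_le_of_norm_le (hμ.const_mul Cσ) (Eventually.of_forall fun p => ?_)
  rw [Real.norm_eq_abs, abs_mul, mul_comm]
  exact mul_le_mul_of_nonneg_right (hσ _) (abs_nonneg _)

lemma aux_dnorm {d' : ℕ} {x : Data d'} {C : ℝ} (h : dnorm x ≤ C) : ‖x.1‖ ≤ C ∧ |x.2| ≤ C := by
  constructor
  · refine le_trans ?_ h
    exact Real.le_sqrt_of_sq_le (by nlinarith [sq_nonneg x.2])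
  · refine le_trans ?_ h
    exact Real.le_sqrt_of_sq_le (by rw [sq_abs]; nlinarith [sq_nonneg ‖x.1‖])

lemma aux_pnorm {d' : ℕ} {x : Param d'} {C : ℝ} (h : pnorm x ≤ C) : |x.1| ≤ C ∧ ‖x.2‖ ≤ C := by
  constructor
  · refine le_trans ?_ h
    exact Real.le_sqrt_of_sq_le (by rw [sq_abs]; nlinarith [sq_nonneg ‖x.2‖])
  · refine le_trans ?_ h
    exact Real.le_sqrt_of_sq_le (by nlinarith [sq_nonneg x.1])

lemma aux_pnorm_le {d' : ℕ} {x : Param d'} {A B : ℝ} (h : |x.1| ≤ A) (h' : ‖x.2‖ ≤ B) :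
    pnorm x ≤ A + B := by
  have hA := (abs_nonneg _).trans h
  have hB := (norm_nonneg _).trans h'
  refine Real.sqrt_le_iff.mpr ⟨by positivity, ?_⟩
  rw [← sq_abs x.1]
  have h1 : |x.1| ^ 2 ≤ A ^ 2 := by gcongr
  have h2 : ‖x.2‖ ^ 2 ≤ B ^ 2 := by gcongr
  nlinarith

lemma aux_supp {d' : ℕ} {π : Measure (Data d')} {C : ℝ} (h : ∀ᵐ x ∂π, dnorm x ≤ C)
    {x : Data d'} (hx : x ∈ msupport π) : dnorm x ≤ C := by
  by_contra hc
  push Not at hc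
  have hcont : Continuous (dnorm : Data d' → ℝ) := by
    unfold dnorm; fun_prop
  refine hx {x | C < dnorm x} ((isOpen_lt continuous_const hcont).mem_nhds hc) ?_
  rw [ae_iff] at h
  simpa using h

lemma aux_lossG {d' : ℕ} {σ : ℝ → ℝ} {Cσ Cπ : ℝ} (hσ : ∀ u, |σ u| ≤ Cσ)
    {x : Data d'} (hx : dnorm x ≤ Cπ) {μ : Measure (Param d')}
    (hμ : Integrable (fun p : Param d' => |p.1|) μ) :
    |lossG σ x μ| ≤ Cπ + Cσ * ∫ p, |p.1| ∂μ := by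
  have h1 := aux_netF hσ x.1 hμ
  have h2 := (aux_dnorm hx).2
  rw [lossG]
  exact (abs_sub _ _).trans (add_le_add h2 h1)

/-- uniform bound on the trajectories of weak solutions of the evolution
equation, when the data distribution and the kernel are supported in compact balls. -/
theorem weak_solution_trajectories_bounded (Cσ Lσ Cν Cπ T : ℝ)
    (hCσ : 1 ≤ Cσ) (hLσ : 1 < Lσ) (hCν : 1 ≤ Cν) (hCπ : 1 ≤ Cπ) (hT : 0 < T) :
    ∃ Ctraj : ℝ, 0 < Ctraj ∧
      ∀ (d' : ℕ) (σ : ℝ → ℝ), Differentiable ℝ σ → (∀ u, |σ u| ≤ Cσ) →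
        (∀ u, |deriv σ u| ≤ Cσ) →
        LipschitzWith (Real.toNNReal Lσ) σ → LipschitzWith (Real.toNNReal Lσ) (deriv σ) →
      ∀ ν : Measure (Param d'), IsProbabilityMeasure ν → (∀ᵐ p ∂ν, pnorm p ≤ Cν) →
      ∀ π : Measure (Data d'), IsProbabilityMeasure π → (∀ᵐ x ∂π, dnorm x ≤ Cπ) →
      ∀ κ : Kernel ℝ (Data d'), IsMarkovKernel κ →
        (∀ᵐ s ∂(volume.restrict (Set.Icc (0 : ℝ) T)), κ s (msupport π)ᶜ = 0) →
      ∀ η : Measure (PathSpace d' T), IsProbabilityMeasure η →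
        η.map (fun θ : PathSpace d' T => θ ⟨0, Set.left_mem_Icc.mpr hT.le⟩) = ν →
        (∀ s : Set.Icc (0 : ℝ) T,
          Integrable (fun p : Param d' => |p.1|) (η.map (fun θ : PathSpace d' T => θ s))) →
        (∀ᵐ θ ∂η,
          (∀ s : Set.Icc (0 : ℝ) T,
            Integrable (fun x => gradA σ x (θ s) (η.map (fun ω : PathSpace d' T => ω s)))
              (κ (s : ℝ))) ∧
          Integrable (fun s : Set.Icc (0 : ℝ) T =>
            ∫ x, gradA σ x (θ s) (η.map (fun ω : PathSpace d' T => ω s)) ∂(κ (s : ℝ))) ∧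
          ∀ t : Set.Icc (0 : ℝ) T,
            θ t = θ ⟨0, Set.left_mem_Icc.mpr hT.le⟩ +
              ∫ s in {u : Set.Icc (0 : ℝ) T | (u : ℝ) ≤ (t : ℝ)},
                ∫ x, gradA σ x (θ s) (η.map (fun ω : PathSpace d' T => ω s)) ∂(κ (s : ℝ))) →
        ∀ᵐ θ ∂η, ∀ t : Set.Icc (0 : ℝ) T, pnorm (θ t) ≤ Ctraj := by
  set a : ℝ := Cπ * Cσ with ha_def
  set b : ℝ := Cσ * Cσ with hb_def
  have ha : 0 ≤ a := by positivity
  have hb : 0 < b := by positivity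
  set M : ℝ := Bseq Cν a b ⌈T * (2 * b)⌉₊ with hM_def
  have hM : 0 ≤ M := Bseq_nonneg (by linarith) ha hb _
  set Cc : ℝ := Cν + (a + b * M) * T with hCc
  have hCc0 : 0 < Cc := by positivity
  set Cw : ℝ := Cν + ((Cπ + Cσ * M) * Cc * Cσ * Cπ) * T with hCw
  have hCw0 : 0 < Cw := by positivity
  refine ⟨Cc + Cw, by positivity, ?_⟩
  intro d' σ _ hσ hσ' _ _ ν hν hνb π hπ hπb κ hκ hκs η hη hη0 hint hsol
  set z0 : Icc (0 : ℝ) T := ⟨0, Set.left_mem_Icc.mpr hT.le⟩ with hz0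
  -- evaluation maps
  have hev : ∀ s : Icc (0 : ℝ) T, Measurable (fun θ : PathSpace d' T => θ s) :=
    fun s => (continuous_eval_const s).measurable
  set μ : Icc (0 : ℝ) T → Measure (Param d') :=
    fun s => η.map (fun ω : PathSpace d' T => ω s) with hμ
  set q : Icc (0 : ℝ) T → ℝ := fun s => ∫ p, |p.1| ∂(μ s) with hq
  have hqη : ∀ s, q s = ∫ θ : PathSpace d' T, |(θ s).1| ∂η := by
    intro s
    exact integral_map (hev s).aemeasurable (hint s).aestronglyMeasurable
  have hintη : ∀ s, Integrable (fun θ : PathSpace d' T => |(θ s).1|) η := by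
    intro s
    exact (integrable_map_measure (hint s).aestronglyMeasurable (hev s).aemeasurable).mp (hint s)
  have hq0 : ∀ s, 0 ≤ q s := fun s => integral_nonneg fun p => abs_nonneg _
  -- the kernel lives in the ball
  have hκb : ∀ᵐ s : Icc (0 : ℝ) T, ∀ᵐ x ∂(κ (s : ℝ)), dnorm x ≤ Cπ := by
    have := (ae_restrict_iff_subtype measurableSet_Icc).mp hκs
    refine Eventually.mono this fun s hs => ?_
    refine measure_mono_null (fun x hx hx' => hx (aux_supp hπb hx')) hs
  -- initial bound
  have hinit : ∀ᵐ θ ∂η, pnorm (θ z0) ≤ Cν := by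
    rw [← hη0] at hνb
    exact ae_of_ae_map (hev z0).aemeasurable hνb
  -- first component bound
  have hfst : ∀ s : Icc (0 : ℝ) T, (∀ᵐ x ∂(κ (s : ℝ)), dnorm x ≤ Cπ) → ∀ θ : PathSpace d' T,
      Integrable (fun x => gradA σ x (θ s) (μ s)) (κ (s : ℝ)) →
      ‖(∫ x, gradA σ x (θ s) (μ s) ∂(κ (s : ℝ))).1‖ ≤ a + b * q s := by
    intro s hs θ hi
    rw [fst_integral hi]
    have := norm_integral_le_of_norm_le_const (μ := κ (s : ℝ))
      (f := fun x => (gradA σ x (θ s) (μ s)).1) (C := a + b * q s) (by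
        filter_upwards [hs] with x hx
        have h1 := aux_lossG hσ hx (hint s)
        simp only [gradA, Real.norm_eq_abs, abs_mul]
        calc _ ≤ (Cπ + Cσ * q s) * Cσ :=
              mul_le_mul h1 (hσ _) (abs_nonneg _) ((abs_nonneg _).trans h1)
          _ = a + b * q s := by rw [ha_def, hb_def]; ring)
    simpa using this
  have hsnd : ∀ s : Icc (0 : ℝ) T, (∀ᵐ x ∂(κ (s : ℝ)), dnorm x ≤ Cπ) → ∀ θ : PathSpace d' T,
      Integrable (fun x => gradA σ x (θ s) (μ s)) (κ (s : ℝ)) →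
      ‖(∫ x, gradA σ x (θ s) (μ s) ∂(κ (s : ℝ))).2‖ ≤
        (Cπ + Cσ * q s) * |(θ s).1| * Cσ * Cπ := by
    intro s hs θ hi
    rw [snd_integral hi]
    have := norm_integral_le_of_norm_le_const (μ := κ (s : ℝ))
      (f := fun x => (gradA σ x (θ s) (μ s)).2)
      (C := (Cπ + Cσ * q s) * |(θ s).1| * Cσ * Cπ) (by
        filter_upwards [hs] with x hx
        have h1 : |lossG σ x (μ s)| ≤ Cπ + Cσ * q s := aux_lossG hσ hx (hint s)
        have h2 := (aux_dnorm hx).1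
        have h3 := hσ' ⟪x.1, (θ s).2⟫_ℝ
        have := hq0 s
        simp only [gradA, norm_smul, Real.norm_eq_abs, abs_mul]
        gcongr)
    simpa using this
  -- increments of the first component
  have hinc : ∀ s t : Icc (0 : ℝ) T, s ≤ t → ∀ S : ℝ, (∀ r ∈ Icc s t, q r ≤ S) →
      ∀ᵐ θ ∂η, |(θ t).1 - (θ s).1| ≤ (a + b * S) * ((t : ℝ) - s) := by
    intro s t hst S hS
    filter_upwards [hsol] with θ hθ
    obtain ⟨h1, h2, h3⟩ := hθ
    have h4 := aux_incr h2.fst s t hst (a + b * S) (by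
      filter_upwards [hκb] with u hu hust
      refine (hfst u hu θ (h1 u)).trans ?_
      have := hS u hust
      gcongr)
    rw [h3 t, h3 s, Prod.fst_add, Prod.fst_add, fst_integral h2.integrableOn,
      fst_integral h2.integrableOn, add_sub_add_left_eq_sub]
    exact h4
  -- the scalar function
  set m : ℝ → ℝ := fun x => q (projIcc 0 T hT.le x) with hm
  have hmq : ∀ s : Icc (0 : ℝ) T, m s = q s := fun s => by
    simp only [hm, projIcc_val]
  have hqdiff : ∀ s t : Icc (0 : ℝ) T, ∀ D : ℝ,
      (∀ᵐ θ : PathSpace d' T ∂η, |(θ t).1 - (θ s).1| ≤ D) → q t ≤ q s + D := by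
    intro s t D hD
    rw [hqη, hqη]
    have : ∫ θ : PathSpace d' T, |(θ t).1| ∂η ≤ ∫ θ : PathSpace d' T, (|(θ s).1| + D) ∂η := by
      refine integral_mono_ae (hintη t) ((hintη s).add (integrable_const D)) ?_
      filter_upwards [hD] with θ hθ
      have := abs_sub_abs_le_abs_sub (θ t).1 (θ s).1
      linarith
    rw [integral_add (hintη s) (integrable_const D)] at this
    simpa using this
  have hmM : ∀ x ∈ Icc 0 T, m x ≤ M := by
    refine aux_final ha hb hT.le (fun x => hq0 _) ?_ ?_ ?_
    · have : m 0 = q z0 := hmq z0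
      rw [this, hqη]
      have : ∫ θ : PathSpace d' T, |(θ z0).1| ∂η ≤ ∫ θ : PathSpace d' T, Cν ∂η := by
        refine integral_mono_ae (hintη z0) (integrable_const _) ?_
        filter_upwards [hinit] with θ hθ
        exact (aux_pnorm hθ).1
      simpa using this
    · intro S
      rw [← isSeqClosed_iff_isClosed]
      intro x y hx hxy
      refine ⟨isClosed_Icc.isSeqClosed (fun n => (hx n).1) hxy, ?_⟩
      have hS0 : 0 ≤ S := (hq0 _).trans (hx 0).2
      have hqe : ∀ s, ENNReal.ofReal (q s) = ∫⁻ θ : PathSpace d' T, ‖|(θ s).1|‖ₑ ∂η := by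
        intro s
        rw [hqη, ← ofReal_integral_norm_eq_lintegral_enorm (hintη s)]
        simp
      have hlim : ∀ θ : PathSpace d' T, Tendsto (fun n => ‖|(θ (projIcc 0 T hT.le (x n))).1|‖ₑ)
          atTop (𝓝 ‖|(θ (projIcc 0 T hT.le y)).1|‖ₑ) := by
        intro θ
        have hc : Continuous fun x : ℝ => ‖|(θ (projIcc 0 T hT.le x)).1|‖ₑ :=
          (continuous_abs.comp (continuous_fst.comp
            (θ.continuous.comp continuous_projIcc))).enorm
        exact (hc.tendsto y).comp hxy
      have : ENNReal.ofReal (m y) ≤ ENNReal.ofReal S := by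
        simp only [hm]
        rw [hqe]
        calc _ = ∫⁻ θ : PathSpace d' T,
              liminf (fun n => ‖|(θ (projIcc 0 T hT.le (x n))).1|‖ₑ) atTop ∂η := by
              congr 1; ext θ; exact (hlim θ).liminf_eq.symm
          _ ≤ liminf (fun n => ∫⁻ θ : PathSpace d' T,
              ‖|(θ (projIcc 0 T hT.le (x n))).1|‖ₑ ∂η) atTop := by
              apply lintegral_liminf_le
              intro n
              exact ((measurable_fst.comp (hev _)).abs).enorm
          _ ≤ ENNReal.ofReal S := by
              refine liminf_le_of_le (by isBoundedDefault) fun c hc => ?_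
              obtain ⟨n, hn⟩ := hc.exists
              refine hn.trans ?_
              rw [← hqe]
              exact ENNReal.ofReal_le_ofReal (hx n).2
      exact (ENNReal.ofReal_le_ofReal_iff hS0).mp this
    · intro s hs t ht S hS
      have e1 : m s = q ⟨s, hs⟩ := hmq ⟨s, hs⟩
      have e2 : m t = q ⟨t, ht⟩ := hmq ⟨t, ht⟩
      rw [e1, e2]
      apply hqdiff
      rcases le_total s t with hst | hst
      · rw [uIcc_of_le hst] at hS
        filter_upwards [hinc ⟨s, hs⟩ ⟨t, ht⟩ hst S
          (fun r hr => (hmq r) ▸ hS r ⟨hr.1, hr.2⟩)] with θ hθ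
        rw [abs_of_nonneg (sub_nonneg.mpr hst), mul_comm]
        exact hθ
      · rw [uIcc_of_ge hst] at hS
        filter_upwards [hinc ⟨t, ht⟩ ⟨s, hs⟩ hst S
          (fun r hr => (hmq r) ▸ hS r ⟨hr.1, hr.2⟩)] with θ hθ
        rw [abs_sub_comm t s, abs_of_nonneg (sub_nonneg.mpr hst), mul_comm, abs_sub_comm]
        exact hθ
  have hqM : ∀ s, q s ≤ M := fun s => hmq s ▸ hmM s s.2
  filter_upwards [hsol, hinit] with θ hθ hθ0
  obtain ⟨h1, h2, h3⟩ := hθ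
  have hz : ∀ t : Icc (0 : ℝ) T, z0 ≤ t := fun t => t.2.1
  have hd : ∀ t : Icc (0 : ℝ) T, (t : ℝ) - (z0 : ℝ) ≤ T := fun t => by
    have := t.2.2
    simp only [hz0]; linarith
  have hc : ∀ t : Icc (0 : ℝ) T, |(θ t).1| ≤ Cc := by
    intro t
    have h4 := aux_incr h2.fst z0 t (hz t) (a + b * M) (by
      filter_upwards [hκb] with u hu _
      refine (hfst u hu θ (h1 u)).trans ?_
      have := hqM u
      gcongr)
    have h5 : |(θ t).1 - (θ z0).1| ≤ (a + b * M) * T := by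
      have e : θ t - θ z0 = _ :=
        (congrArg₂ (fun x y => x - y) (h3 t) (h3 z0)).trans (add_sub_add_left_eq_sub _ _ _)
      rw [← Prod.fst_sub, e, Prod.fst_sub, fst_integral h2.integrableOn, fst_integral h2.integrableOn]
      refine h4.trans ?_
      have := hd t
      gcongr
    have h6 := abs_sub_abs_le_abs_sub (θ t).1 (θ z0).1
    have h7 := (aux_pnorm hθ0).1
    linarith
  intro t
  refine aux_pnorm_le (hc t) ?_
  have h4 := aux_incr h2.snd z0 t (hz t) ((Cπ + Cσ * M) * Cc * Cσ * Cπ) (by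
    filter_upwards [hκb] with u hu _
    refine (hsnd u hu θ (h1 u)).trans ?_
    have := hqM u
    have := hc u
    gcongr)
  have h5 : ‖(θ t).2 - (θ z0).2‖ ≤ ((Cπ + Cσ * M) * Cc * Cσ * Cπ) * T := by
    have e : θ t - θ z0 = _ :=
      (congrArg₂ (fun x y => x - y) (h3 t) (h3 z0)).trans (add_sub_add_left_eq_sub _ _ _)
    rw [← Prod.snd_sub, e, Prod.snd_sub, snd_integral h2.integrableOn, snd_integral h2.integrableOn]
    refine h4.trans ?_
    have := hd t
    gcongr
  have h6 := norm_sub_norm_le (θ t).2 (θ z0).2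
  have h7 := (aux_pnorm hθ0).2
  linarith
end
end
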